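/- arXiv:2401.16892 — 2 statements merged into one kernel-verified Lean document; each statement's English description precedes it below -/
import Mathlib

section
/- Let B be a finite left brace of cardinality m·n with gcd(m,n) = 1, let B1 and B2 be the (unique) additive subgroups of (B,+) of orders m and n respectively, and assume B1 and B2 are closed under ∘ and that B1 is a normal subgroup of the multiplicative group (B,∘). Then for every a ∈ B1 and b ∈ B2 one has λ_a(b) = b, that is, a ∘ b = a + b. -/
/-- A left brace structure on an additive commutative group `B`: a second group
operation `circ` (with inverse `inv` and identity `0`) satisfying the left brace
compatibility law `a ∘ (b + c) + a = a ∘ b + a ∘ c`. -/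
structure BraceMul (B : Type*) [AddCommGroup B] where
  circ : B → B → B
  inv : B → B
  circ_assoc : ∀ a b c, circ (circ a b) c = circ a (circ b c)
  zero_circ : ∀ a, circ 0 a = a
  circ_zero : ∀ a, circ a 0 = a
  inv_circ : ∀ a, circ (inv a) a = 0
  circ_inv : ∀ a, circ a (inv a) = 0
  compat : ∀ a b c, circ a (b + c) + a = circ a b + circ a c

/-- The lambda map of a left brace: `λ_a(b) = -a + a ∘ b`. -/
def BraceMul.lam {B : Type*} [AddCommGroup B] (br : BraceMul B) (a b : B) : B :=
  -a + br.circ a b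

namespace BraceMul

variable {B : Type*} [AddCommGroup B] (br : BraceMul B)

theorem circ_eq_add_lam (a b : B) : br.circ a b = a + br.lam a b := by
  simp [lam]

/-- The map `λ_a` as an additive endomorphism. -/
def lamHom (a : B) : B →+ B :=
  AddMonoidHom.mk' (br.lam a) fun b c => by
    have h : br.circ a (b + c) = br.circ a b + br.circ a c - a :=
      eq_sub_of_add_eq (br.compat a b c)
    simp only [lam, h]
    abel

theorem nsmul_lam_eq_zero {k : ℕ} {b : B} (a : B) (hb : k • b = 0) : k • br.lam a b = 0 := by
  change k • br.lamHom a b = 0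
  rw [← map_nsmul, hb, map_zero]

theorem inv_inv (a : B) : br.inv (br.inv a) = a := by
  rw [← br.circ_zero (br.inv (br.inv a)), ← br.inv_circ a, ← br.circ_assoc, br.inv_circ,
    br.zero_circ]

/-- If `a` and its conjugate `b⁻¹ ∘ a ∘ b` are killed by `m` and `b` is killed by `n`, with `m` and
`n` coprime, then `λ_a` fixes `b`. -/
theorem lam_eq_self_of_coprime {m n : ℕ} (hmn : Nat.Coprime m n) {a b : B} (ha : m • a = 0)
    (hb : n • b = 0) (hconj : m • br.circ (br.circ (br.inv b) a) b = 0) : br.lam a b = b := by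
  set c := br.circ (br.circ (br.inv b) a) b with hc
  have hcomm : a + br.lam a b = b + br.lam b c := by
    rw [← circ_eq_add_lam, ← circ_eq_add_lam, hc, ← br.circ_assoc, ← br.circ_assoc, br.circ_inv,
      br.zero_circ]
  have hdiff : br.lam a b - b = br.lam b c - a := by
    rw [sub_eq_sub_iff_add_eq_add, add_comm, hcomm, add_comm]
  have hn : n • (br.lam a b - b) = 0 := by
    rw [nsmul_sub, br.nsmul_lam_eq_zero a hb, hb, sub_zero]
  have hm : m • (br.lam a b - b) = 0 := by
    rw [hdiff, nsmul_sub, br.nsmul_lam_eq_zero b hconj, ha, sub_zero]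
  have hdvd := Nat.dvd_gcd (addOrderOf_dvd_of_nsmul_eq_zero hm) (addOrderOf_dvd_of_nsmul_eq_zero hn)
  rw [hmn.gcd_eq_one, Nat.dvd_one, AddMonoid.addOrderOf_eq_one_iff] at hdvd
  exact sub_eq_zero.mp hdvd

end BraceMul

/-- An element of an additive subgroup is killed by the order of the subgroup. -/
theorem AddSubgroup.card_nsmul_eq_zero_of_mem {A : Type*} [AddGroup A] (H : AddSubgroup A) {x : A}
    (hx : x ∈ H) : Nat.card H • x = 0 :=
  congrArg Subtype.val (card_nsmul_eq_zero' (x := (⟨x, hx⟩ : H)))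

theorem statement2 (m n : ℕ) (hmn : Nat.Coprime m n)
    (B : Type) [AddCommGroup B] [Finite B] (br : BraceMul B)
    (hcard : Nat.card B = m * n)
    (B1 B2 : AddSubgroup B) (hB1 : Nat.card B1 = m) (hB2 : Nat.card B2 = n)
    (hB1circ : ∀ a ∈ B1, ∀ b ∈ B1, br.circ a b ∈ B1)
    (hB2circ : ∀ a ∈ B2, ∀ b ∈ B2, br.circ a b ∈ B2)
    (hB1norm : ∀ g : B, ∀ a ∈ B1, br.circ (br.circ g a) (br.inv g) ∈ B1) :
    ∀ a ∈ B1, ∀ b ∈ B2, br.lam a b = b ∧ br.circ a b = a + b := by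
  intro a ha b hb
  have hconj := hB1norm (br.inv b) a ha
  rw [br.inv_inv] at hconj
  have hlam : br.lam a b = b :=
    br.lam_eq_self_of_coprime hmn (hB1 ▸ B1.card_nsmul_eq_zero_of_mem ha)
      (hB2 ▸ B2.card_nsmul_eq_zero_of_mem hb) (hB1 ▸ B1.card_nsmul_eq_zero_of_mem hconj)
  exact ⟨hlam, by rw [br.circ_eq_add_lam, hlam]⟩
end

section
/- Let p and q be primes with q > p, q ≥ 5, p | q−1, p ∤ q+1 and p² ∤ q−1, and let λ be a fixed generator of the unique subgroup of order p of (ℤ/qℤ)*. Then the subgroup D of GL(2, ℤ/qℤ) consisting of all diagonal matrices diag(λ^i, λ^j) (i, j ∈ ℤ) has order p², it is a Sylow p-subgroup of GL(2, ℤ/qℤ), and every subgroup of order p² of GL(2, ℤ/qℤ) is conjugate to D. -/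
open Matrix

/-- The diagonal matrix `diag(a, b)` with unit entries, as an element of `GL(2, R)`. -/
def diagGL {R : Type*} [CommRing R] (a b : Rˣ) : GL (Fin 2) R where
  val := Matrix.diagonal ![(a : R), (b : R)]
  inv := Matrix.diagonal ![((a⁻¹ : Rˣ) : R), ((b⁻¹ : Rˣ) : R)]
  val_inv := by
    rw [Matrix.diagonal_mul_diagonal]
    have h : (fun i => ![(a : R), (b : R)] i * ![((a⁻¹ : Rˣ) : R), ((b⁻¹ : Rˣ) : R)] i)
        = (1 : Fin 2 → R) := by
      funext i; fin_cases i <;> simp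
    rw [h]; exact Matrix.diagonal_one
  inv_val := by
    rw [Matrix.diagonal_mul_diagonal]
    have h : (fun i => ![((a⁻¹ : Rˣ) : R), ((b⁻¹ : Rˣ) : R)] i * ![(a : R), (b : R)] i)
        = (1 : Fin 2 → R) := by
      funext i; fin_cases i <;> simp
    rw [h]; exact Matrix.diagonal_one

/-- The homomorphism `(a, b) ↦ diag(a, b)` from `Rˣ × Rˣ` to `GL(2, R)`. -/
def diagGLHom (R : Type*) [CommRing R] : Rˣ × Rˣ →* GL (Fin 2) R where
  toFun x := diagGL x.1 x.2
  map_one' := by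
    ext i j
    fin_cases i <;> fin_cases j <;> simp [diagGL]
  map_mul' x y := by
    ext i j
    fin_cases i <;> fin_cases j <;> simp [diagGL]

theorem diagGLHom_injective (R : Type*) [CommRing R] :
    Function.Injective (diagGLHom R) := by
  intro x y h
  have h' : Matrix.diagonal ![(x.1 : R), (x.2 : R)] = Matrix.diagonal ![(y.1 : R), (y.2 : R)] :=
    congrArg Units.val h
  rw [Matrix.diagonal_injective.eq_iff] at h'
  ext
  · simpa using congrFun h' 0
  · simpa using congrFun h' 1

theorem card_GL_two_zmod (q : ℕ) [Fact q.Prime] :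
    Nat.card (GL (Fin 2) (ZMod q)) = (q + 1) * q * (q - 1) ^ 2 := by
  rw [Matrix.card_GL_field]
  obtain ⟨n, rfl⟩ : ∃ n, q = n + 1 := ⟨q - 1, by have := (Fact.out : q.Prime).pos; omega⟩
  simp only [Fin.prod_univ_two, ZMod.card, Fin.val_zero, Fin.val_one, pow_zero, pow_one,
    Nat.add_sub_cancel]
  have e1 : (n + 1) ^ 2 - 1 = n * (n + 2) := by
    rw [Nat.sub_eq_iff_eq_add (Nat.one_le_pow _ _ (by omega))]; ring
  have e2 : (n + 1) ^ 2 - (n + 1) = n * (n + 1) := by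
    rw [Nat.sub_eq_iff_eq_add (Nat.le_self_pow (by omega) _)]; ring
  rw [e1, e2]
  ring

/-- Under the divisibility assumptions, `p ^ 2` is the exact power of `p` dividing
`|GL(2, ℤ/qℤ)|`. -/
theorem factorization_card_GL_two_zmod {p q : ℕ} (hp : p.Prime) [Fact q.Prime]
    (hpq : p < q) (h1 : p ∣ q - 1) (h2 : ¬ p ∣ q + 1) (h3 : ¬ p ^ 2 ∣ q - 1) :
    (Nat.card (GL (Fin 2) (ZMod q))).factorization p = 2 := by
  have hq : q.Prime := Fact.out
  have hq1 : q - 1 ≠ 0 := by have := hq.two_le; omega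
  have hpq' : ¬ p ∣ q := fun h => hpq.ne ((Nat.prime_dvd_prime_iff_eq hp hq).1 h)
  have hv : (q - 1).factorization p = 1 := by
    refine le_antisymm ?_ ((hp.dvd_iff_one_le_factorization hq1).1 h1)
    by_contra! h
    exact h3 ((hp.pow_dvd_iff_le_factorization hq1).2 h)
  rw [card_GL_two_zmod, Nat.factorization_mul (mul_ne_zero (by omega) hq.ne_zero)
    (pow_ne_zero _ hq1), Nat.factorization_mul (by omega) hq.ne_zero, Nat.factorization_pow]
  simp [Nat.factorization_eq_zero_of_not_dvd h2, Nat.factorization_eq_zero_of_not_dvd hpq', hv]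

theorem statement12 (p q : ℕ) (hp : p.Prime) (hq : q.Prime)
    (hpq : p < q) (hq5 : 5 ≤ q)
    (h1 : p ∣ q - 1) (h2 : ¬ p ∣ q + 1) (h3 : ¬ p ^ 2 ∣ q - 1)
    -- `lam` is a generator of the unique subgroup of order `p` of `(ℤ/qℤ)*`
    (lam : (ZMod q)ˣ) (hlam : orderOf lam = p) :
    ∃ D : Subgroup (GL (Fin 2) (ZMod q)),
      (D : Set (GL (Fin 2) (ZMod q)))
          = {x | ∃ i j : ℤ, x = diagGL (lam ^ i) (lam ^ j)} ∧
      Nat.card D = p ^ 2 ∧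
      (∃ P : Sylow p (GL (Fin 2) (ZMod q)), (P : Subgroup (GL (Fin 2) (ZMod q))) = D) ∧
      (∀ H : Subgroup (GL (Fin 2) (ZMod q)), Nat.card H = p ^ 2 →
        ∃ g : GL (Fin 2) (ZMod q), Subgroup.map (MulAut.conj g).toMonoidHom H = D) := by
  have : Fact p.Prime := ⟨hp⟩
  have : Fact q.Prime := ⟨hq⟩
  have hfac := factorization_card_GL_two_zmod hp hpq h1 h2 h3
  let D : Subgroup (GL (Fin 2) (ZMod q)) :=
    ((Subgroup.zpowers lam).prod (Subgroup.zpowers lam)).map (diagGLHom (ZMod q))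
  have hD : Nat.card D = p ^ 2 := by
    rw [Subgroup.card_map_of_injective (diagGLHom_injective (ZMod q)),
      Nat.card_congr (Subgroup.prodEquiv _ _).toEquiv, Nat.card_prod, Nat.card_zpowers, hlam, sq]
  let P : Sylow p (GL (Fin 2) (ZMod q)) := Sylow.ofCard D (by rw [hD, hfac])
  refine ⟨D, ?_, hD, ⟨P, rfl⟩, fun H hH => ?_⟩
  · ext x
    constructor
    · rintro ⟨⟨_, _⟩, ⟨⟨i, rfl⟩, ⟨j, rfl⟩⟩, rfl⟩
      exact ⟨i, j, rfl⟩
    · rintro ⟨i, j, rfl⟩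
      exact ⟨(lam ^ i, lam ^ j), ⟨⟨i, rfl⟩, ⟨j, rfl⟩⟩, rfl⟩
  · let Q : Sylow p (GL (Fin 2) (ZMod q)) := Sylow.ofCard H (by rw [hH, hfac])
    obtain ⟨g, hg⟩ := MulAction.exists_smul_eq (GL (Fin 2) (ZMod q)) Q P
    exact ⟨g, congrArg Sylow.toSubgroup hg⟩
end
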